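/- arXiv:1803.08452 — 2 statements merged into one kernel-verified Lean document; each statement's English description precedes it below -/
import Mathlib

section
/- Let S, T be commutative K-algebras, π : S → T a surjective K-algebra homomorphism, L : S → S a linear differential operator of order ≤ k, and L' : T → T a K-linear map with π ∘ L = L' ∘ π. Then L' is a linear differential operator of order ≤ k, and for every K-algebra homomorphism h : T → K and all f₁, …, f_k ∈ S, (δ_h(π(f₁))⋯δ_h(π(f_k))(h ∘ L'))(1_T) = (δ_{h∘π}(f₁)⋯δ_{h∘π}(f_k)((h∘π) ∘ L))(1_S). -/
universe u

variable {K : Type u} [CommRing K]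

/-- Scalar multiplication by `f ∈ A` on an `A`-module, as a `K`-linear map. -/
def smulK {A : Type u} [CommRing A] [Algebra K A]
    (P : Type u) [AddCommGroup P] [Module A P] [Module K P] [IsScalarTower K A P]
    (f : A) : P →ₗ[K] P :=
  (LinearMap.lsmul A P f).restrictScalars K

/-- `δ(f)Φ : S → S`, `(δ(f)Φ)(g) = Φ(fg) − f·Φ(g)`. -/
def deltaOp {S : Type u} [CommRing S] [Algebra K S] (f : S) (Φ : S →ₗ[K] S) : S →ₗ[K] S :=
  Φ ∘ₗ smulK S f - smulK S f ∘ₗ Φ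

/-- Iterated `δ`: `deltaChain [f₁,…,f_j] Φ = δ(f₁)δ(f₂)⋯δ(f_j)Φ`. -/
def deltaChain {S : Type u} [CommRing S] [Algebra K S] (fs : List S) (Φ : S →ₗ[K] S) :
    S →ₗ[K] S :=
  fs.foldr deltaOp Φ

/-- A linear differential operator of order `≤ k` on a `K`-algebra `S`. -/
def IsLDO {S : Type u} [CommRing S] [Algebra K S] (k : ℕ) (L : S →ₗ[K] S) : Prop :=
  ∀ f : Fin (k + 1) → S, deltaChain (List.ofFn f) L = 0

/-- `δ_{h'}(f)Ψ : S → K`, `(δ_{h'}(f)Ψ)(g) = Ψ(fg) − h'(f)·Ψ(g)`. -/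
def deltaH {S : Type u} [CommRing S] [Algebra K S] (h' : S →ₐ[K] K) (f : S)
    (Ψ : S →ₗ[K] K) : S →ₗ[K] K :=
  Ψ ∘ₗ smulK S f - h' f • Ψ

/-- Iterated `δ_{h'}`. -/
def deltaHChain {S : Type u} [CommRing S] [Algebra K S] (h' : S →ₐ[K] K) (fs : List S)
    (Ψ : S →ₗ[K] K) : S →ₗ[K] K :=
  fs.foldr (deltaH h') Ψ

/-- `δ` is natural along an algebra homomorphism intertwining two operators. -/
theorem deltaChain_map {S T : Type u} [CommRing S] [CommRing T] [Algebra K S] [Algebra K T]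
    (π : S →ₐ[K] T) (L : S →ₗ[K] S) (L' : T →ₗ[K] T) (hL : ∀ s, π (L s) = L' (π s))
    (fs : List S) (s : S) :
    π (deltaChain fs L s) = deltaChain (fs.map π) L' (π s) := by
  induction fs generalizing s with
  | nil => exact hL s
  | cons f fs ih =>
    change π (deltaChain fs L (f * s) - f * deltaChain fs L s) =
      deltaChain (fs.map π) L' (π f * π s) - π f * deltaChain (fs.map π) L' (π s)
    rw [map_sub, ih, map_mul π, map_mul π, ih]

/-- `δ_h` is natural along an algebra homomorphism. -/
theorem deltaHChain_map {S T : Type u} [CommRing S] [CommRing T] [Algebra K S] [Algebra K T]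
    (π : S →ₐ[K] T) (h : T →ₐ[K] K) (Φ : S →ₗ[K] K) (Ψ : T →ₗ[K] K)
    (hΦ : ∀ s, Φ s = Ψ (π s)) (fs : List S) (s : S) :
    deltaHChain h (fs.map π) Ψ (π s) = deltaHChain (h.comp π) fs Φ s := by
  induction fs generalizing s with
  | nil => exact (hΦ s).symm
  | cons f fs ih =>
    change deltaHChain h (fs.map π) Ψ (π f * π s) - h (π f) * deltaHChain h (fs.map π) Ψ (π s) =
      deltaHChain (h.comp π) fs Φ (f * s) - h (π f) * deltaHChain (h.comp π) fs Φ s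
    rw [← map_mul, ih, ih]

/-- If `π : S → T` is a surjective `K`-algebra homomorphism, `L` is an LDO of order `≤ k` on
`S` and `π ∘ L = L' ∘ π`, then `L'` is an LDO of order `≤ k` and its principal symbol at any
`K`-point `h` of `T` pulls back to the principal symbol of `L` at `h ∘ π`. -/
theorem inducedLDO_of_surjective
    {S T : Type u} [CommRing S] [CommRing T] [Algebra K S] [Algebra K T]
    (π : S →ₐ[K] T) (hπ : Function.Surjective π) (k : ℕ)
    (L : S →ₗ[K] S) (hL : IsLDO k L)
    (L' : T →ₗ[K] T) (hLL' : π.toLinearMap ∘ₗ L = L' ∘ₗ π.toLinearMap) :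
    IsLDO k L' ∧
      ∀ (h : T →ₐ[K] K) (f : Fin k → S),
        (deltaHChain h (List.ofFn fun i => π (f i)) (h.toLinearMap ∘ₗ L')) 1
          = (deltaHChain (h.comp π) (List.ofFn f) ((h.comp π).toLinearMap ∘ₗ L)) 1 := by
  have hcomm : ∀ s, π (L s) = L' (π s) := LinearMap.congr_fun hLL'
  refine ⟨fun f => ?_, fun h f => ?_⟩
  · ext t
    obtain ⟨s, rfl⟩ := hπ t
    choose g hg using fun i => hπ (f i)
    have hf : List.ofFn f = (List.ofFn g).map π := by
      rw [List.map_ofFn]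
      exact congrArg List.ofFn (funext fun i => (hg i).symm)
    rw [hf, ← deltaChain_map π L L' hcomm, hL g]
    simp
  · have key := deltaHChain_map π h ((h.comp π).toLinearMap ∘ₗ L) (h.toLinearMap ∘ₗ L')
      (fun s => congrArg h (hcomm s)) (List.ofFn f) 1
    rw [map_one, List.map_ofFn] at key
    exact key
end

section
/- Let S, T be commutative K-algebras, π : S → T a surjective K-algebra homomorphism, k ≥ 1, L : S → S a linear differential operator of order ≤ k, and L' : T → T a K-linear map with π ∘ L = L' ∘ π. Assume that for every K-algebra homomorphism h : T → K, L is elliptic of order k at h∘π, i.e. for every f ∈ ker(h∘π) with f ∉ (ker(h∘π))², one has (h∘π)(L(f^k)) ≠ 0. Then L' is a linear differential operator of order ≤ k, and for every K-algebra homomorphism h : T → K and every g ∈ ker h with g ∉ (ker h)², one has h(L'(g^k)) ≠ 0. -/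
universe u

variable {K : Type u} [CommRing K]

/-- A homomorphism intertwining `L` and `L'` intertwines their iterated `δ`'s. -/
theorem map_deltaChain_apply {S T : Type u} [CommRing S] [CommRing T] [Algebra K S] [Algebra K T]
    (π : S →ₐ[K] T) {L : S →ₗ[K] S} {L' : T →ₗ[K] T} (hLL' : ∀ x, π (L x) = L' (π x))
    (fs : List S) (x : S) :
    π (deltaChain fs L x) = deltaChain (fs.map π) L' (π x) := by
  induction fs generalizing x with
  | nil => exact hLL' x
  | cons f fs ih =>
    change π (deltaChain fs L (f * x) - f * deltaChain fs L x) =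
      deltaChain (fs.map π) L' (π f * π x) - π f * deltaChain (fs.map π) L' (π x)
    rw [map_sub, map_mul π, ih, ih, map_mul π]

/-- Linear differential operators descend along surjective homomorphisms. -/
theorem IsLDO.of_surjective {S T : Type u} [CommRing S] [CommRing T] [Algebra K S] [Algebra K T]
    {π : S →ₐ[K] T} (hπ : Function.Surjective π) {k : ℕ} {L : S →ₗ[K] S} (hL : IsLDO k L)
    {L' : T →ₗ[K] T} (hLL' : ∀ x, π (L x) = L' (π x)) : IsLDO k L' := by
  intro g
  choose f hf using fun i => hπ (g i)
  ext y
  obtain ⟨x, rfl⟩ := hπ y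
  have hg : List.ofFn g = (List.ofFn f).map π := by
    rw [List.map_ofFn]
    exact congrArg List.ofFn (funext fun i => (hf i).symm)
  rw [hg, ← map_deltaChain_apply π hLL', hL f]
  simp

/-- Ellipticity is preserved by surjective homomorphisms of `K`-algebras: if `π : S → T` is a
surjective `K`-algebra homomorphism, `L` is an LDO of order `≤ k` on `S` which is elliptic of
order `k` at `h ∘ π` for every `K`-point `h` of `T` (encoded via the principal symbol:
`(h∘π)(L(f^k)) ≠ 0` for every `f ∈ ker(h∘π)` with `f ∉ (ker(h∘π))²`), and `π ∘ L = L' ∘ π`,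
then `L'` is an LDO of order `≤ k` which is elliptic in the same sense at every `K`-point of
`T`. -/
theorem elliptic_of_surjective
    {S T : Type u} [CommRing S] [CommRing T] [Algebra K S] [Algebra K T]
    (π : S →ₐ[K] T) (hπ : Function.Surjective π) (k : ℕ) (hk : 1 ≤ k)
    (L : S →ₗ[K] S) (hL : IsLDO k L)
    (L' : T →ₗ[K] T) (hLL' : π.toLinearMap ∘ₗ L = L' ∘ₗ π.toLinearMap)
    (hell : ∀ h : T →ₐ[K] K, ∀ f ∈ RingHom.ker (h.comp π),
      f ∉ (RingHom.ker (h.comp π)) ^ 2 → (h.comp π) (L (f ^ k)) ≠ 0) :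
    IsLDO k L' ∧
      ∀ h : T →ₐ[K] K, ∀ g ∈ RingHom.ker h,
        g ∉ (RingHom.ker h) ^ 2 → h (L' (g ^ k)) ≠ 0 := by
  have hcomm : ∀ x, π (L x) = L' (π x) := fun x => LinearMap.congr_fun hLL' x
  refine ⟨hL.of_surjective hπ hcomm, fun h g hg hg2 => ?_⟩
  obtain ⟨f, rfl⟩ := hπ g
  have hmap : (RingHom.ker (h.comp π)).map π ≤ RingHom.ker h :=
    Ideal.map_le_iff_le_comap.2 fun _ hx => hx
  have hf := hell h f hg fun hf2 => hg2 <| by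
    refine Ideal.pow_right_mono hmap 2 ?_
    rw [← Ideal.map_pow]
    exact Ideal.mem_map_of_mem π hf2
  rwa [AlgHom.comp_apply, hcomm, map_pow] at hf
end
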